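/- Let T be a triangulation of a set S of N points in the plane in general position, let F be a set of N/2 − 2 ps-flippable edges of T, and let G be a plane graph on S all of whose edges belong to T. If exactly j edges of F do not belong to G, then supp(G) ≥ 2^j, i.e., G is contained in at least 2^j triangulations of S. -/

import Mathlib

open scoped Classical

noncomputable section

/-- Points of the plane. -/
abbrev Pt : Type := ℝ × ℝ

/-- A finite point set is in general position if no three of its points are collinear. -/
def GenPos (S : Finset Pt) : Prop :=
  ∀ p ∈ S, ∀ q ∈ S, ∀ r ∈ S, p ≠ q → p ≠ r → q ≠ r →
    ¬ Collinear ℝ ({p, q, r} : Set Pt)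

/-- The closed straight segment spanned by an unordered pair of points. -/
def seg2 (e : Sym2 Pt) : Set Pt :=
  Sym2.lift ⟨fun p q => segment ℝ p q, fun p q => segment_symm ℝ p q⟩ e

/-- A crossing-free straight-edge graph (plane graph) on the point set `S`:
its edges are straight segments between points of `S`, any two of which
meet only at shared endpoints. -/
structure PlaneGraph (S : Finset Pt) where
  edges : Finset (Sym2 Pt)
  endpoint_mem : ∀ e ∈ edges, ∀ p, p ∈ e → p ∈ S
  not_isDiag : ∀ e ∈ edges, ¬ e.IsDiag
  noncrossing : ∀ e₁ ∈ edges, ∀ e₂ ∈ edges, e₁ ≠ e₂ →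
    ∀ x ∈ seg2 e₁ ∩ seg2 e₂, x ∈ e₁ ∧ x ∈ e₂

/-- A triangulation of `S` is a maximal plane graph on `S`. -/
def IsTriangulation {S : Finset Pt} (T : PlaneGraph S) : Prop :=
  ∀ G : PlaneGraph S, T.edges ⊆ G.edges → G.edges = T.edges

/-- `tr S`: the number of triangulations of `S`. -/
def triCount (S : Finset Pt) : ℕ :=
  Nat.card {T : PlaneGraph S // IsTriangulation T}

/-- A plane graph is a spanning cycle of `S` if its edges form a Hamiltonian
cycle on `S`. -/
def IsSpanningCycle {S : Finset Pt} (G : PlaneGraph S) : Prop :=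
  3 ≤ S.card ∧ ∃ f : Fin S.card ≃ {p : Pt // p ∈ S},
    G.edges =
      Finset.image (fun i : Fin S.card => s(((f i : Pt)), ((f (finRotate S.card i) : Pt)))) Finset.univ

/-- `sc S`: the number of crossing-free straight-edge spanning cycles of `S`. -/
def scCount (S : Finset Pt) : ℕ :=
  Nat.card {G : PlaneGraph S // IsSpanningCycle G}

/-- A plane graph is a perfect matching of `S` if every point of `S` is incident
to exactly one edge. -/
def IsPerfectMatching {S : Finset Pt} (G : PlaneGraph S) : Prop :=
  ∀ p ∈ S, ∃! e, e ∈ G.edges ∧ p ∈ e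

/-- `pm S`: the number of crossing-free straight-edge perfect matchings of `S`. -/
def pmCount (S : Finset Pt) : ℕ :=
  Nat.card {G : PlaneGraph S // IsPerfectMatching G}

/-- The support of a plane graph `G` on `S`: the number of triangulations of `S`
containing all edges of `G`. -/
def supp {S : Finset Pt} (G : PlaneGraph S) : ℕ :=
  Nat.card {T : PlaneGraph S // IsTriangulation T ∧ G.edges ⊆ T.edges}

/-- A finite set of points is in (strictly) convex position. -/
def InConvexPosition (Q : Finset Pt) : Prop :=
  ∀ p ∈ Q, p ∉ convexHull ℝ (↑(Q.erase p) : Set Pt)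

/-- `p q` is an edge of the convex hull boundary of `Q`. -/
def IsHullEdgeOf (Q : Finset Pt) (p q : Pt) : Prop :=
  p ∈ Q ∧ q ∈ Q ∧ p ≠ q ∧
    segment ℝ p q ⊆ frontier (convexHull ℝ (Q : Set Pt))

/-- `e` is a diagonal of the convex polygon with vertex set `Q`. -/
def IsDiagonalOf (Q : Finset Pt) (e : Sym2 Pt) : Prop :=
  ∃ p ∈ Q, ∃ q ∈ Q, e = s(p, q) ∧
    openSegment ℝ p q ⊆ interior (convexHull ℝ (Q : Set Pt))

/-- `F` is a set of ps-flippable (pseudo-simultaneously flippable) edges of the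
triangulation `T`: the edges of `F` are diagonals of pairwise interior-disjoint
(empty) convex polygons whose boundary edges all belong to `T`. -/
def IsPsFlippable {S : Finset Pt} (T : PlaneGraph S) (F : Finset (Sym2 Pt)) : Prop :=
  F ⊆ T.edges ∧
  ∃ 𝒬 : Finset (Finset Pt),
    (∀ Q ∈ 𝒬, ↑Q ⊆ (S : Set Pt) ∧ 3 ≤ Q.card ∧ InConvexPosition Q ∧
      (∀ p q, IsHullEdgeOf Q p q → s(p, q) ∈ T.edges) ∧
      (∀ p ∈ S, p ∉ interior (convexHull ℝ (Q : Set Pt)))) ∧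
    (∀ Q ∈ 𝒬, ∀ Q' ∈ 𝒬, Q ≠ Q' →
      interior (convexHull ℝ (Q : Set Pt)) ∩ interior (convexHull ℝ (Q' : Set Pt)) = ∅) ∧
    (∀ e ∈ F, ∃ Q ∈ 𝒬, IsDiagonalOf Q e)

/-- The drawing of a plane graph: the union of its (closed) edge segments and
its vertex set. -/
def drawing {S : Finset Pt} (G : PlaneGraph S) : Set Pt :=
  (⋃ e ∈ G.edges, seg2 e) ∪ (S : Set Pt)

/-- A convex decomposition of `S`: a plane graph containing all convex hull
boundary edges, whose bounded faces are all convex, and with no isolated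
vertices. -/
def IsConvexDecomposition {S : Finset Pt} (D : PlaneGraph S) : Prop :=
  (∀ p q, IsHullEdgeOf S p q → s(p, q) ∈ D.edges) ∧
  (∀ x ∉ drawing D, Bornology.IsBounded (connectedComponentIn (drawing D)ᶜ x) →
    Convex ℝ (connectedComponentIn (drawing D)ᶜ x)) ∧
  (∀ p ∈ S, ∃ e ∈ D.edges, p ∈ e)

/-- `p` is an interior vertex of `S` (not on the convex hull boundary). -/
def InteriorVtx (S : Finset Pt) (p : Pt) : Prop :=
  p ∈ S ∧ p ∉ frontier (convexHull ℝ (S : Set Pt))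

/-- `p` has a valid triple of edges in `G`. -/
def IsValidAt {S : Finset Pt} (G : PlaneGraph S) (p : Pt) : Prop :=
  ∃ a ∈ S, ∃ b ∈ S, ∃ c ∈ S,
    p ∈ convexHull ℝ ({a, b, c} : Set Pt) ∧
    s(p, a) ∈ G.edges ∧ s(p, b) ∈ G.edges ∧ s(p, c) ∈ G.edges

/-- The degree of a point in a plane graph. -/
def degree {S : Finset Pt} (G : PlaneGraph S) (p : Pt) : ℕ :=
  (G.edges.filter (fun e => p ∈ e)).card

/-- `a b c` span a triangular face of the triangulation `T`. -/
def IsTriFace {S : Finset Pt} (T : PlaneGraph S) (a b c : Pt) : Prop :=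
  a ∈ S ∧ b ∈ S ∧ c ∈ S ∧
  s(a, b) ∈ T.edges ∧ s(b, c) ∈ T.edges ∧ s(a, c) ∈ T.edges ∧
  ∀ p ∈ S, p ∉ interior (convexHull ℝ ({a, b, c} : Set Pt))

/-- An edge of a triangulation is flippable if its two incident triangles form
a convex quadrilateral. -/
def IsFlippable {S : Finset Pt} (T : PlaneGraph S) (e : Sym2 Pt) : Prop :=
  e ∈ T.edges ∧ ∃ a b c d : Pt, e = s(a, b) ∧ c ≠ d ∧
    IsTriFace T a b c ∧ IsTriFace T a b d ∧
    (openSegment ℝ a b ∩ openSegment ℝ c d).Nonempty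

/-- `flip T`: the number of flippable edges of `T`. -/
def flipCount {S : Finset Pt} (T : PlaneGraph S) : ℕ :=
  (T.edges.filter (fun e => IsFlippable T e)).card

/-- `v3 T`: the number of interior vertices of degree 3 in `T`. -/
def v3 {S : Finset Pt} (T : PlaneGraph S) : ℕ :=
  (S.filter (fun p => p ∉ frontier (convexHull ℝ (S : Set Pt)) ∧ degree T p = 3)).card

/-- The number of vertices of `S` on its convex hull boundary. -/
def hullVtxCount (S : Finset Pt) : ℕ :=
  (S.filter (fun p => p ∈ frontier (convexHull ℝ (S : Set Pt)))).card

/-- Orientation determinant. -/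
def orD (p q x : Pt) : ℝ := (q.1 - p.1) * (x.2 - p.2) - (q.2 - p.2) * (x.1 - p.1)

lemma orD_combo (p q a b : Pt) (s t : ℝ) (h : s + t = 1) :
    orD p q (s • a + t • b) = s * orD p q a + t * orD p q b := by
  obtain rfl : s = 1 - t := by linarith
  simp only [orD, Prod.fst_add, Prod.snd_add, Prod.smul_fst, Prod.smul_snd, smul_eq_mul]
  ring

lemma orD_swap (p q x : Pt) : orD q p x = - orD p q x := by
  simp only [orD]; ring

lemma orD_left (p q : Pt) : orD p q p = 0 := by simp [orD]

lemma orD_right (p q : Pt) : orD p q q = 0 := by simp only [orD]; ring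

lemma orD_param {p q x : Pt} (hpq : p ≠ q) (h : orD p q x = 0) :
    ∃ l : ℝ, x = p + l • (q - p) := by
  have hne : (q.1 - p.1) ^ 2 + (q.2 - p.2) ^ 2 ≠ 0 := by
    intro h0
    apply hpq
    have h1 : q.1 - p.1 = 0 := by nlinarith [sq_nonneg (q.1 - p.1), sq_nonneg (q.2 - p.2)]
    have h2 : q.2 - p.2 = 0 := by nlinarith [sq_nonneg (q.1 - p.1), sq_nonneg (q.2 - p.2)]
    exact Prod.ext (by linarith) (by linarith)
  refine ⟨((x.1 - p.1) * (q.1 - p.1) + (x.2 - p.2) * (q.2 - p.2)) /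
    ((q.1 - p.1) ^ 2 + (q.2 - p.2) ^ 2), ?_⟩
  simp only [orD] at h
  ext
  · simp only [Prod.fst_add, Prod.smul_fst, Prod.fst_sub, smul_eq_mul]
    field_simp
    linear_combination (-(q.2 - p.2)) * h
  · simp only [Prod.snd_add, Prod.smul_snd, Prod.snd_sub, smul_eq_mul]
    field_simp
    linear_combination (q.1 - p.1) * h

lemma genPos_orD {S : Finset Pt} (hS : GenPos S) {p q x : Pt} (hp : p ∈ S) (hq : q ∈ S)
    (hx : x ∈ S) (hpq : p ≠ q) (h : orD p q x = 0) : x = p ∨ x = q := by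
  by_contra! hc
  apply hS p hp q hq x hx hpq hc.1.symm hc.2.symm
  rw [collinear_iff_of_mem (p₀ := p) (by simp)]
  obtain ⟨l, hl⟩ := orD_param hpq h
  refine ⟨q - p, ?_⟩
  intro z hz
  simp only [Set.mem_insert_iff, Set.mem_singleton_iff] at hz
  rcases hz with rfl | rfl | rfl
  · exact ⟨0, by simp⟩
  · exact ⟨1, by simp⟩
  · exact ⟨l, by rw [hl]; simp [add_comm]⟩

lemma seg_mk (p q : Pt) : seg2 s(p, q) = segment ℝ p q := rfl

/-- A point of `S` lying on a segment between points of `S` is an endpoint. -/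
lemma genPos_seg {S : Finset Pt} (hS : GenPos S) {p q x : Pt} (hp : p ∈ S) (hq : q ∈ S)
    (hx : x ∈ S) (hpq : p ≠ q) (h : x ∈ segment ℝ p q) : x = p ∨ x = q := by
  apply genPos_orD hS hp hq hx hpq
  obtain ⟨s, t, _, _, h1, rfl⟩ := h
  rw [orD_combo _ _ _ _ _ _ h1, orD_left, orD_right]; simp

/-- Separated chords of a convex polygon cross. -/
lemma cross_of_sep {Q : Finset Pt} (hQ : InConvexPosition Q) {p q c d : Pt} (hp : p ∈ Q)
    (hq : q ∈ Q) (hc : c ∈ Q) (hd : d ∈ Q) (h : orD p q c * orD p q d < 0) :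
    ∃ x, x ∈ openSegment ℝ p q ∧ x ∈ openSegment ℝ c d := by
  have hpq : p ≠ q := by rintro rfl; simp [orD] at h
  have hcp : c ≠ p := by rintro rfl; simp [orD] at h
  have hcq : c ≠ q := by rintro rfl; simp [orD_right] at h
  have hdp : d ≠ p := by rintro rfl; simp [orD] at h
  have hdq : d ≠ q := by rintro rfl; simp [orD_right] at h
  obtain ⟨s, t, hs, ht, hst, h0⟩ : ∃ s t : ℝ, 0 < s ∧ 0 < t ∧ s + t = 1 ∧
      s * orD p q c + t * orD p q d = 0 := by
    generalize orD p q c = u at *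
    generalize orD p q d = v at *
    rcases mul_neg_iff.1 h with ⟨hu, hv⟩ | ⟨hu, hv⟩
    · have : 0 < u - v := by linarith
      refine ⟨-v / (u - v), u / (u - v), div_pos (by linarith) this, div_pos hu this, ?_, ?_⟩
      · field_simp; ring
      · field_simp; ring
    · have : 0 < v - u := by linarith
      refine ⟨v / (v - u), -u / (v - u), div_pos hv this, div_pos (by linarith) this, ?_, ?_⟩
      · field_simp; ring
      · field_simp; ring
  set x := s • c + t • d with hx
  have hxo : x ∈ openSegment ℝ c d := ⟨s, t, hs, ht, hst, rfl⟩
  have hx0 : orD p q x = 0 := by rw [hx, orD_combo _ _ _ _ _ _ hst, h0]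
  obtain ⟨l, hl⟩ := orD_param hpq hx0
  have key : ∀ r ∈ Q, ∀ r' ∈ Q, r' ≠ r → c ≠ r → d ≠ r → r ∈ segment ℝ x r' → False := by
    intro r hr r' hr' h1 h2 h3 h4
    apply hQ r hr
    have hcv := convex_convexHull ℝ (↑(Q.erase r) : Set Pt)
    have hsub := subset_convexHull ℝ (↑(Q.erase r) : Set Pt)
    have e1 : r' ∈ convexHull ℝ (↑(Q.erase r) : Set Pt) := hsub (by simp [h1, hr'])
    have e2 : c ∈ convexHull ℝ (↑(Q.erase r) : Set Pt) := hsub (by simp [h2, hc])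
    have e3 : d ∈ convexHull ℝ (↑(Q.erase r) : Set Pt) := hsub (by simp [h3, hd])
    exact hcv.segment_subset (hcv.openSegment_subset e2 e3 hxo) e1 h4
  refine ⟨x, ?_, hxo⟩
  by_cases h1 : l ≤ 0
  · exfalso
    apply key p hp q hq hpq.symm hcp hdp
    have : 0 < 1 - l := by linarith
    refine ⟨1 / (1 - l), -l / (1 - l), by positivity, div_nonneg (by linarith) this.le, ?_, ?_⟩
    · field_simp; ring
    · rw [hl]
      ext <;> simp <;> field_simp <;> ring
  by_cases h2 : 1 ≤ l
  · exfalso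
    apply key q hq p hp hpq hcq hdq
    have : 0 < l := by linarith
    refine ⟨1 / l, (l - 1) / l, by positivity, div_nonneg (by linarith) this.le, ?_, ?_⟩
    · field_simp; ring
    · rw [hl]
      ext <;> simp <;> field_simp <;> ring
  push Not at h1 h2
  refine ⟨1 - l, l, by linarith, h1, by ring, ?_⟩
  rw [hl]; ext <;> simp <;> ring

/-- Frontier points of a polygon are vertices or lie on hull edges. -/
lemma frontier_cases {S : Finset Pt} (hS : GenPos S) {Q : Finset Pt} (hQS : ↑Q ⊆ (S : Set Pt))
    (hne : (interior (convexHull ℝ (Q : Set Pt))).Nonempty) {y : Pt}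
    (hy : y ∈ frontier (convexHull ℝ (Q : Set Pt))) :
    y ∈ Q ∨ ∃ u v, IsHullEdgeOf Q u v ∧ y ∈ segment ℝ u v := by
  have hcv := convex_convexHull ℝ (Q : Set Pt)
  have hcl : IsClosed (convexHull ℝ (Q : Set Pt)) := Q.finite_toSet.isClosed_convexHull (𝕜 := ℝ)
  have hyK : y ∈ convexHull ℝ (Q : Set Pt) := hcl.frontier_subset hy
  obtain ⟨f, hf⟩ := geometric_hahn_banach_open_point hcv.interior isOpen_interior hy.2
  have hle : ∀ z ∈ convexHull ℝ (Q : Set Pt), f z ≤ f y := by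
    intro z hz
    have hz' : z ∈ closure (interior (convexHull ℝ (Q : Set Pt))) := by
      rw [hcv.closure_interior_eq_closure_of_nonempty_interior hne]
      exact subset_closure hz
    have hc : IsClosed {z : Pt | f z ≤ f y} := isClosed_le f.continuous continuous_const
    exact closure_minimal (fun w hw => (hf w hw).le) hc hz'
  have hfne : f (1, 0) ≠ 0 ∨ f (0, 1) ≠ 0 := by
    by_contra! h
    obtain ⟨w, hw⟩ := hne
    have hz : ∀ z : Pt, f z = 0 := by
      intro z
      have : z = z.1 • ((1, 0) : Pt) + z.2 • ((0, 1) : Pt) := by ext <;> simp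
      rw [this, map_add, map_smul, map_smul, h.1, h.2]; simp
    have := hf w hw
    rw [hz, hz] at this
    exact lt_irrefl _ this
  have hfz : ∀ z : Pt, f z = z.1 * f (1, 0) + z.2 * f (0, 1) := by
    intro z
    have : z = z.1 • ((1, 0) : Pt) + z.2 • ((0, 1) : Pt) := by ext <;> simp
    conv_lhs => rw [this, map_add, map_smul, map_smul]
    simp
  have hor : ∀ u v w : Pt, f u = f y → f v = f y → f w = f y → orD u v w = 0 := by
    intro u v w hu hv hw
    rw [hfz u] at hu; rw [hfz v] at hv; rw [hfz w] at hw
    rcases hfne with h | h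
    · apply mul_left_cancel₀ h
      simp only [orD]
      linear_combination (w.2 - u.2) * (hv - hu) - (v.2 - u.2) * (hw - hu)
    · apply mul_left_cancel₀ h
      simp only [orD]
      linear_combination -(w.1 - u.1) * (hv - hu) + (v.1 - u.1) * (hw - hu)
  obtain ⟨w, hw0, hw1, hwy⟩ := Finset.mem_convexHull'.1 hyK
  set M := Q.filter (fun z => f z = f y) with hM
  have hzero : ∀ z ∈ Q, z ∉ M → w z = 0 := by
    have hsum : ∑ z ∈ Q, w z * (f y - f z) = 0 := by
      have h1 : f y = ∑ z ∈ Q, w z * f z := by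
        conv_lhs => rw [← hwy]
        simp [map_sum]
      simp only [mul_sub, Finset.sum_sub_distrib]
      rw [← Finset.sum_mul, hw1, ← h1]; ring
    rw [Finset.sum_eq_zero_iff_of_nonneg] at hsum
    · intro z hz hzM
      rcases mul_eq_zero.1 (hsum z hz) with h | h
      · exact h
      · exact absurd (Finset.mem_filter.2 ⟨hz, by linarith⟩) hzM
    · intro z hz
      exact mul_nonneg (hw0 z hz) (sub_nonneg.2 (hle z (subset_convexHull ℝ _ hz)))
  have hMQ : M ⊆ Q := Finset.filter_subset _ _
  have hw1' : ∑ z ∈ M, w z = 1 := by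
    rw [← hw1]; exact Finset.sum_subset hMQ (fun z hz h => hzero z hz h)
  have hwy' : ∑ z ∈ M, w z • z = y := by
    rw [← hwy]; exact Finset.sum_subset hMQ (fun z hz h => by rw [hzero z hz h, zero_smul])
  have hMf : ∀ z ∈ M, f z = f y := fun z hz => (Finset.mem_filter.1 hz).2
  have hMne : M.Nonempty := by
    by_contra h
    rw [Finset.not_nonempty_iff_eq_empty] at h
    rw [h] at hw1'; simp at hw1'
  obtain ⟨u, hu⟩ := hMne
  by_cases h2 : ∃ v ∈ M, v ≠ u
  · obtain ⟨v, hv, hvu⟩ := h2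
    have hMuv : M = {u, v} := by
      ext z
      simp only [Finset.mem_insert, Finset.mem_singleton]
      constructor
      · intro hz
        exact genPos_orD hS (hQS (hMQ hu)) (hQS (hMQ hv)) (hQS (hMQ hz)) hvu.symm
          (hor u v z (hMf u hu) (hMf v hv) (hMf z hz))
      · rintro (rfl | rfl) <;> assumption
    rw [hMuv, Finset.sum_pair hvu.symm] at hw1' hwy'
    right
    refine ⟨u, v, ⟨hMQ hu, hMQ hv, hvu.symm, ?_⟩, w u, w v, hw0 u (hMQ hu), hw0 v (hMQ hv),
      hw1', hwy'⟩
    intro z hz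
    refine ⟨subset_closure (hcv.segment_subset (subset_convexHull ℝ _ (hMQ hu))
      (subset_convexHull ℝ _ (hMQ hv)) hz), fun hzi => ?_⟩
    obtain ⟨s, t, _, _, hst, rfl⟩ := hz
    have := hf _ hzi
    rw [map_add, map_smul, map_smul, hMf u hu, hMf v hv, ← add_smul, hst, one_smul] at this
    exact lt_irrefl _ this
  · push Not at h2
    have hMu : M = {u} := by
      ext z
      simp only [Finset.mem_singleton]
      exact ⟨h2 z, fun h => h ▸ hu⟩
    rw [hMu, Finset.sum_singleton] at hw1' hwy'
    left
    rw [hw1', one_smul] at hwy'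
    exact hwy' ▸ hMQ hu

lemma exists_frontier {K : Set Pt} {x a : Pt} (hx : x ∈ interior K) (ha : a ∉ interior K) :
    ∃ y ∈ segment ℝ x a, y ∈ frontier K := by
  by_contra! h
  have hpre : IsPreconnected (segment ℝ x a) := (convex_segment x a).isPreconnected
  have hnf : ∀ y ∈ segment ℝ x a, y ∈ closure (interior K) → y ∈ interior K := by
    intro y hy hc
    by_contra hi
    exact h y hy ⟨closure_mono interior_subset hc, hi⟩
  obtain ⟨z, _, hz1, hz2⟩ := hpre (interior K) (closure (interior K))ᶜ isOpen_interior
    isClosed_closure.isOpen_compl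
    (fun y hy => by
      by_cases hc : y ∈ closure (interior K)
      · exact Or.inl (hnf y hy hc)
      · exact Or.inr hc)
    ⟨x, left_mem_segment ℝ x a, hx⟩
    ⟨a, right_mem_segment ℝ x a, fun hc => ha (hnf a (right_mem_segment ℝ x a) hc)⟩
  exact hz2 (subset_closure hz1)

/-- The per-polygon conditions in `IsPsFlippable`. -/
def GoodPoly {S : Finset Pt} (T : PlaneGraph S) (Q : Finset Pt) : Prop :=
  ↑Q ⊆ (S : Set Pt) ∧ 3 ≤ Q.card ∧ InConvexPosition Q ∧
      (∀ p q, IsHullEdgeOf Q p q → s(p, q) ∈ T.edges) ∧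
      (∀ p ∈ S, p ∉ interior (convexHull ℝ (Q : Set Pt)))

/-- An edge passing through the interior of a good polygon has its endpoints in it. -/
lemma endpoint_in_poly {S : Finset Pt} (hS : GenPos S) {T : PlaneGraph S} {Q : Finset Pt}
    (hQ : GoodPoly T Q) {a b x : Pt} (hab : s(a, b) ∈ T.edges) (hx : x ∈ openSegment ℝ a b)
    (hxi : x ∈ interior (convexHull ℝ (Q : Set Pt))) : a ∈ Q := by
  obtain ⟨hQS, _, _, hhull, hemp⟩ := hQ
  have haS := T.endpoint_mem _ hab a (by simp)
  have hbS := T.endpoint_mem _ hab b (by simp)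
  have hne : a ≠ b := by
    intro h; exact T.not_isDiag _ hab (by simpa using h)
  obtain ⟨y, hy, hyf⟩ := exists_frontier hxi (hemp a haS)
  have hxs : x ∈ segment ℝ a b := openSegment_subset_segment ℝ a b hx
  have hys : y ∈ segment ℝ a b :=
    (convex_segment a b).segment_subset hxs (left_mem_segment ℝ a b) hy
  have hfin : y ∈ Q ∧ (y = a ∨ y = b) := by
    rcases frontier_cases hS hQS ⟨x, hxi⟩ hyf with h | ⟨u, v, huv, hyuv⟩
    · exact ⟨h, genPos_seg hS haS hbS (hQS h) hne hys⟩
    · have hT := hhull u v huv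
      have hneq : s(a, b) ≠ s(u, v) := by
        intro h
        have h1 : x ∈ seg2 s(u, v) := by rw [← h]; exact hxs
        exact (huv.2.2.2 h1).2 hxi
      have := T.noncrossing _ hab _ hT hneq y ⟨hys, hyuv⟩
      simp only [Sym2.mem_iff] at this
      refine ⟨?_, this.1⟩
      rcases this.2 with h | h
      · rw [h]; exact huv.1
      · rw [h]; exact huv.2.1
  rcases hfin.2 with h | h
  · exact h ▸ hfin.1
  · exfalso
    subst h
    obtain ⟨s, t, hs, ht, hst, rfl⟩ := hx
    obtain ⟨s', t', hs', ht', hst', h⟩ := hy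
    have hpos : 0 < 1 - s' * t := by
      have : s' * t ≤ 1 * t := mul_le_mul_of_nonneg_right (by linarith) ht.le
      linarith
    obtain rfl : s = 1 - t := by linarith
    obtain rfl : t' = 1 - s' := by linarith
    have h1 := congrArg Prod.fst h
    have h2 := congrArg Prod.snd h
    simp only [Prod.fst_add, Prod.smul_fst, Prod.snd_add, Prod.smul_snd, smul_eq_mul] at h1 h2
    apply hne
    ext
    · apply mul_left_cancel₀ hpos.ne'
      linear_combination h1
    · apply mul_left_cancel₀ hpos.ne'
      linear_combination h2

/-- Edges of `T` spanned by points of `Q` which separate `c` from `d`. -/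
def crSet {S : Finset Pt} (T : PlaneGraph S) (Q : Finset Pt) (c d : Pt) : Finset (Sym2 Pt) :=
  T.edges.filter (fun f => ∃ a ∈ Q, ∃ b ∈ Q, f = s(a, b) ∧ orD a b c * orD a b d < 0)

lemma crSet_comm {S : Finset Pt} (T : PlaneGraph S) (Q : Finset Pt) (c d : Pt) :
    crSet T Q c d = crSet T Q d c := by
  simp only [crSet, mul_comm]

lemma not_mem_endpoints {p q x : Pt} (hpq : p ≠ q) (hx : x ∈ openSegment ℝ p q) :
    x ∉ s(p, q) := by
  rw [Sym2.mem_iff]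
  rintro (rfl | rfl)
  · exact hpq (left_mem_openSegment_iff.1 hx)
  · exact hpq (right_mem_openSegment_iff.1 hx)

lemma crSet_lt {S : Finset Pt} {T : PlaneGraph S} {Q : Finset Pt}
    (hQ : InConvexPosition Q) {a b c d : Pt} (ha : a ∈ Q) (hb : b ∈ Q) (hc : c ∈ Q) (hd : d ∈ Q)
    (hab : s(a, b) ∈ T.edges) (hsep : orD a b c * orD a b d < 0) :
    (crSet T Q a d).card < (crSet T Q c d).card := by
  apply Finset.card_lt_card
  have hfn : s(a, b) ∉ crSet T Q a d := by
    intro h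
    obtain ⟨_, u, _, v, _, huv, hlt⟩ := Finset.mem_filter.1 h
    have : orD u v a = 0 := by
      rcases Sym2.eq_iff.1 huv with ⟨rfl, rfl⟩ | ⟨rfl, rfl⟩
      · exact orD_left _ _
      · exact orD_right _ _
    rw [this] at hlt; simp at hlt
  rw [Finset.ssubset_iff_of_subset]
  · exact ⟨s(a, b), Finset.mem_filter.2 ⟨hab, a, ha, b, hb, rfl, hsep⟩, hfn⟩
  intro g hg
  have hgne : g ≠ s(a, b) := by rintro rfl; exact hfn hg
  obtain ⟨hgT, u, hu, v, hv, rfl, hlt⟩ := Finset.mem_filter.1 hg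
  refine Finset.mem_filter.2 ⟨hgT, u, hu, v, hv, rfl, ?_⟩
  have hge : 0 ≤ orD u v a * orD u v b := by
    by_contra! hneg
    obtain ⟨x, hx1, hx2⟩ := cross_of_sep hQ hu hv ha hb hneg
    have := T.noncrossing _ hgT _ hab hgne x
      ⟨openSegment_subset_segment ℝ _ _ hx1, openSegment_subset_segment ℝ _ _ hx2⟩
    refine not_mem_endpoints ?_ hx1 this.1
    rintro rfl
    exact T.not_isDiag _ hgT (by simp)
  obtain ⟨x, ⟨s, t, hs, ht, hst, rfl⟩, ⟨s', t', hs', ht', hst', hx⟩⟩ :=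
    cross_of_sep hQ ha hb hc hd hsep
  have h := congrArg (orD u v) hx
  rw [orD_combo _ _ _ _ _ _ hst, orD_combo _ _ _ _ _ _ hst'] at h
  generalize orD u v a = A at *
  generalize orD u v b = B at *
  generalize orD u v c = C at *
  generalize orD u v d = D at *
  rcases mul_neg_iff.1 hlt with ⟨h1, h2⟩ | ⟨h1, h2⟩
  · have hB : 0 ≤ B := nonneg_of_mul_nonneg_right hge h1
    refine mul_neg_of_pos_of_neg ?_ h2
    by_contra! hC
    nlinarith [mul_pos hs h1, mul_nonneg ht.le hB, mul_pos ht' (neg_pos.2 h2),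
      mul_nonneg hs'.le (neg_nonneg.2 hC)]
  · have hB : B ≤ 0 := by
      by_contra! hB
      nlinarith [mul_pos (neg_pos.2 h1) hB]
    refine mul_neg_of_neg_of_pos ?_ h2
    by_contra! hC
    nlinarith [mul_pos hs (neg_pos.2 h1), mul_nonneg ht.le (neg_nonneg.2 hB), mul_pos ht' h2,
      mul_nonneg hs'.le hC]

lemma exists_sep {Q : Finset Pt} {p q x : Pt} (hpq : p ≠ q) (hx : x ∈ openSegment ℝ p q)
    (hxi : x ∈ interior (convexHull ℝ (Q : Set Pt))) :
    (∃ c ∈ Q, 0 < orD p q c) := by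
  by_contra! h
  have hx0 : orD p q x = 0 := by
    obtain ⟨s, t, _, _, hst, rfl⟩ := hx
    rw [orD_combo _ _ _ _ _ _ hst, orD_left, orD_right]; simp
  have hcv : Convex ℝ {z : Pt | orD p q z ≤ 0} := by
    intro z hz w hw s t hs ht hst
    simp only [Set.mem_ofPred_eq] at *
    rw [orD_combo _ _ _ _ _ _ hst]
    nlinarith
  have hsub : convexHull ℝ (Q : Set Pt) ⊆ {z : Pt | orD p q z ≤ 0} :=
    convexHull_min (fun z hz => h z hz) hcv
  have hnh := mem_interior_iff_mem_nhds.1 hxi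
  have hcont : Continuous (fun t : ℝ => x + t • ((-(q.2 - p.2), q.1 - p.1) : Pt)) := by fun_prop
  have hev : ∀ᶠ t : ℝ in nhds 0, x + t • ((-(q.2 - p.2), q.1 - p.1) : Pt) ∈
      convexHull ℝ (Q : Set Pt) := by
    apply hcont.continuousAt.eventually_mem
    simpa using hnh
  have hev' := hev.filter_mono (nhdsWithin_le_nhds (s := Set.Ioi (0 : ℝ)))
  obtain ⟨t, ht, ht0⟩ := (hev'.and self_mem_nhdsWithin).exists
  have ht1 := hsub ht
  simp only [Set.mem_ofPred_eq] at ht1 ht0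
  have hpos : 0 < (q.1 - p.1) ^ 2 + (q.2 - p.2) ^ 2 := by
    by_contra! h0
    apply hpq
    have h1 : q.1 - p.1 = 0 := by nlinarith [sq_nonneg (q.1 - p.1), sq_nonneg (q.2 - p.2)]
    have h2 : q.2 - p.2 = 0 := by nlinarith [sq_nonneg (q.1 - p.1), sq_nonneg (q.2 - p.2)]
    exact Prod.ext (by linarith) (by linarith)
  have : orD p q (x + t • ((-(q.2 - p.2), q.1 - p.1) : Pt)) =
      orD p q x + t * ((q.1 - p.1) ^ 2 + (q.2 - p.2) ^ 2) := by
    simp [orD]; ring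
  rw [this, hx0] at ht1
  nlinarith [mul_pos ht0 hpos]

/-- The flip: an edge crossing only the diagonal `s(p, q)`. -/
lemma exists_flip {S : Finset Pt} (hS : GenPos S) {T : PlaneGraph S} {Q : Finset Pt}
    (hQ : GoodPoly T Q) {p q : Pt} (hp : p ∈ Q) (hq : q ∈ Q) (hpqT : s(p, q) ∈ T.edges)
    (hdiag : openSegment ℝ p q ⊆ interior (convexHull ℝ (Q : Set Pt))) :
    ∃ c d : Pt, c ∈ S ∧ d ∈ S ∧ c ≠ d ∧ s(c, d) ≠ s(p, q) ∧
      (∃ x, x ∈ openSegment ℝ p q ∧ x ∈ openSegment ℝ c d) ∧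
      ∀ f ∈ T.edges, f ≠ s(p, q) → ∀ x ∈ segment ℝ c d ∩ seg2 f, x ∈ s(c, d) ∧ x ∈ f := by
  have hQ' := hQ
  obtain ⟨hQS, _, hconv, hhull, hemp⟩ := hQ'
  have hpq : p ≠ q := by
    rintro rfl
    exact T.not_isDiag _ hpqT (by simp)
  have hm : (midpoint ℝ p q) ∈ openSegment ℝ p q := midpoint_mem_openSegment p q
  obtain ⟨c₀, hc₀, hc₀'⟩ := exists_sep hpq hm (hdiag hm)
  obtain ⟨d₀, hd₀, hd₀'⟩ := exists_sep hpq.symm (by rwa [openSegment_symm]) (hdiag hm)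
  rw [orD_swap] at hd₀'
  set P := (Q ×ˢ Q).filter (fun z => orD p q z.1 * orD p q z.2 < 0) with hP
  have hPne : P.Nonempty := ⟨(c₀, d₀), by
    simp only [hP, Finset.mem_filter, Finset.mem_product]
    exact ⟨⟨hc₀, hd₀⟩, by nlinarith⟩⟩
  obtain ⟨⟨c, d⟩, hcd, hmin⟩ := Finset.exists_min_image P (fun z => (crSet T Q z.1 z.2).card) hPne
  simp only [hP, Finset.mem_filter, Finset.mem_product] at hcd
  obtain ⟨⟨hc, hd⟩, hsep⟩ := hcd
  have hmin' : ∀ c' ∈ Q, ∀ d' ∈ Q, orD p q c' * orD p q d' < 0 →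
      (crSet T Q c d).card ≤ (crSet T Q c' d').card := by
    intro c' hc' d' hd' h
    exact hmin (c', d') (by simp only [hP, Finset.mem_filter, Finset.mem_product]
                            exact ⟨⟨hc', hd'⟩, h⟩)
  have hcdne : c ≠ d := by
    rintro rfl
    nlinarith [mul_self_nonneg (orD p q c)]
  have hcdpq : s(c, d) ≠ s(p, q) := by
    intro h
    rcases Sym2.eq_iff.1 h with ⟨rfl, rfl⟩ | ⟨rfl, rfl⟩
    · simp [orD_left] at hsep
    · simp [orD_left] at hsep
  -- no other edge separates
  have haux : ∀ a ∈ Q, ∀ b ∈ Q, s(a, b) ∈ T.edges → orD a b c * orD a b d < 0 →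
      orD p q a = 0 := by
    intro a ha b hb hab hs
    by_contra hne
    have l1 := crSet_lt hconv ha hb hc hd hab hs
    have l2 := crSet_lt hconv ha hb hd hc hab (by rwa [mul_comm])
    rw [crSet_comm T Q d c] at l2
    have m1 : ¬ orD p q a * orD p q d < 0 := fun h => absurd (hmin' a ha d hd h) (by omega)
    have m2 : ¬ orD p q a * orD p q c < 0 := fun h => absurd (hmin' a ha c hc h) (by omega)
    push Not at m1 m2
    have h3 := mul_nonneg m1 m2
    have h4 : 0 < orD p q a ^ 2 := by positivity
    have h5 := mul_pos h4 (neg_pos.2 hsep)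
    nlinarith
  have hno : ∀ a ∈ Q, ∀ b ∈ Q, s(a, b) ∈ T.edges → s(a, b) ≠ s(p, q) →
      ¬ orD a b c * orD a b d < 0 := by
    intro a ha b hb hab hne hs
    have h1 := haux a ha b hb hab hs
    have h2 := haux b hb a ha (by rwa [Sym2.eq_swap]) (by
      rw [orD_swap a b, orD_swap a b]; linarith)
    have hne' : a ≠ b := by
      rintro rfl
      exact T.not_isDiag _ hab (by simp)
    rcases genPos_orD hS (hQS hp) (hQS hq) (hQS ha) hpq h1 with rfl | rfl <;>
    rcases genPos_orD hS (hQS hp) (hQS hq) (hQS hb) hpq h2 with rfl | rfl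
    · exact hne' rfl
    · exact hne rfl
    · exact hne Sym2.eq_swap
    · exact hne' rfl
  obtain ⟨y, hy1, hy2⟩ := cross_of_sep hconv hp hq hc hd hsep
  have hyi := hdiag hy1
  have hint : openSegment ℝ c d ⊆ interior (convexHull ℝ (Q : Set Pt)) := by
    have hr : y ∈ Set.range (AffineMap.lineMap c d : ℝ → Pt) := by
      rw [openSegment_eq_image_lineMap] at hy2
      exact Set.image_subset_range _ _ hy2
    refine (openSegment_subset_union c d hr).trans ?_
    have hcv := convex_convexHull ℝ (Q : Set Pt)
    apply Set.insert_subset hyi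
    apply Set.union_subset
    · rw [openSegment_symm]
      exact hcv.openSegment_interior_self_subset_interior hyi (subset_convexHull ℝ _ hc)
    · exact hcv.openSegment_interior_self_subset_interior hyi (subset_convexHull ℝ _ hd)
  refine ⟨c, d, hQS hc, hQS hd, hcdne, hcdpq, ⟨y, hy1, hy2⟩, ?_⟩
  intro f
  induction f using Sym2.ind with | _ a b => ?_
  intro hf hfe x hx
  obtain ⟨hx1, hx2⟩ := hx
  rw [seg_mk] at hx2
  have haS := T.endpoint_mem _ hf a (by simp)
  have hbS := T.endpoint_mem _ hf b (by simp)
  have hne' : a ≠ b := by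
    rintro rfl
    exact T.not_isDiag _ hf (by simp)
  by_cases hxc : x = c
  · subst hxc
    refine ⟨by simp, ?_⟩
    rw [Sym2.mem_iff]
    exact genPos_seg hS haS hbS (hQS hc) hne' hx2
  by_cases hxd : x = d
  · subst hxd
    refine ⟨by simp, ?_⟩
    rw [Sym2.mem_iff]
    exact genPos_seg hS haS hbS (hQS hd) hne' hx2
  exfalso
  have hxo : x ∈ openSegment ℝ c d := mem_openSegment_of_ne_left_right (Ne.symm hxc) (Ne.symm hxd) hx1
  have hxi := hint hxo
  have hxa : x ≠ a := by rintro rfl; exact hemp _ haS hxi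
  have hxb : x ≠ b := by rintro rfl; exact hemp _ hbS hxi
  have hxo2 : x ∈ openSegment ℝ a b := mem_openSegment_of_ne_left_right hxa.symm hxb.symm hx2
  have haQ := endpoint_in_poly hS hQ hf hxo2 hxi
  have hbQ := endpoint_in_poly hS hQ (a := b) (b := a) (by rwa [Sym2.eq_swap])
    (by rwa [openSegment_symm]) hxi
  have hns := hno a haQ b hbQ hf hfe
  have hx0 : orD a b x = 0 := by
    obtain ⟨s, t, _, _, hst, rfl⟩ := hxo2
    rw [orD_combo _ _ _ _ _ _ hst, orD_left, orD_right]; simp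
  obtain ⟨s, t, hs, ht, hst, hxe⟩ := hxo
  rw [← hxe, orD_combo _ _ _ _ _ _ hst] at hx0
  have hC : orD a b c = 0 := by
    by_contra hC
    apply hns
    have h1 : t * (orD a b c * orD a b d) = - (s * orD a b c ^ 2) := by
      linear_combination (orD a b c) * hx0
    have h2 : 0 < s * orD a b c ^ 2 := by positivity
    by_contra! h3
    nlinarith [mul_nonneg ht.le h3]
  have hD : orD a b d = 0 := by
    rw [hC] at hx0
    simpa [ht.ne'] using hx0
  have hfcd : s(a, b) = s(c, d) := by
    rcases genPos_orD hS haS hbS (hQS hc) hne' hC with rfl | rfl <;>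
    rcases genPos_orD hS haS hbS (hQS hd) hne' hD with rfl | rfl
    · exact absurd rfl hcdne
    · rfl
    · exact Sym2.eq_swap
    · exact absurd rfl hcdne
  have := T.noncrossing _ hf _ hpqT hfe y ⟨by
    rw [hfcd]; exact openSegment_subset_segment ℝ _ _ hy2, openSegment_subset_segment ℝ _ _ hy1⟩
  exact not_mem_endpoints hpq hy1 this.2

lemma PlaneGraph.edges_inj {S : Finset Pt} :
    Function.Injective (fun G : PlaneGraph S => G.edges) := by
  rintro ⟨e, _, _, _⟩ ⟨e', _, _, _⟩ h
  simp only at h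
  subst h
  rfl

lemma PlaneGraph.edges_sub {S : Finset Pt} (G : PlaneGraph S) : G.edges ⊆ S.sym2 := by
  intro e he
  rw [Finset.mem_sym2_iff]
  exact fun p hp => G.endpoint_mem e he p hp

instance planeGraph_finite (S : Finset Pt) : Finite (PlaneGraph S) := by
  have : Finite {E : Finset (Sym2 Pt) // E ∈ S.sym2.powerset} := inferInstance
  refine Finite.of_injective
    (fun G : PlaneGraph S => (⟨G.edges, Finset.mem_powerset.2 G.edges_sub⟩ :
      {E : Finset (Sym2 Pt) // E ∈ S.sym2.powerset})) ?_
  intro G G' h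
  exact PlaneGraph.edges_inj (by simpa using h)

lemma exists_triangulation {S : Finset Pt} (G : PlaneGraph S) :
    ∃ T : PlaneGraph S, IsTriangulation T ∧ G.edges ⊆ T.edges := by
  obtain ⟨T, hT, hmax⟩ := Set.exists_max_image {T : PlaneGraph S | G.edges ⊆ T.edges}
    (fun T => T.edges.card) (Set.toFinite _) ⟨G, Finset.Subset.refl _⟩
  refine ⟨T, ?_, hT⟩
  intro H hH
  exact (Finset.eq_of_subset_of_card_le hH (hmax H (Finset.Subset.trans hT hH))).symm

/-- Add one compatible edge to a plane graph. -/
def addEdge {S : Finset Pt} (T : PlaneGraph S) (e : Sym2 Pt) (c d : Pt) (hc : c ∈ S) (hd : d ∈ S)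
    (hcd : c ≠ d)
    (h : ∀ f ∈ T.edges, f ≠ e → ∀ x ∈ segment ℝ c d ∩ seg2 f, x ∈ s(c, d) ∧ x ∈ f) :
    PlaneGraph S where
  edges := insert s(c, d) (T.edges.erase e)
  endpoint_mem := by
    intro f hf p hp
    rcases Finset.mem_insert.1 hf with rfl | hf
    · rcases Sym2.mem_iff.1 hp with rfl | rfl <;> assumption
    · exact T.endpoint_mem f (Finset.mem_of_mem_erase hf) p hp
  not_isDiag := by
    intro f hf
    rcases Finset.mem_insert.1 hf with rfl | hf
    · simpa using hcd
    · exact T.not_isDiag f (Finset.mem_of_mem_erase hf)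
  noncrossing := by
    intro f hf g hg hfg x hx
    rcases Finset.mem_insert.1 hf with rfl | hf <;> rcases Finset.mem_insert.1 hg with rfl | hg
    · exact absurd rfl hfg
    · exact h g (Finset.mem_of_mem_erase hg) (Finset.ne_of_mem_erase hg) x hx
    · exact (h f (Finset.mem_of_mem_erase hf) (Finset.ne_of_mem_erase hf) x ⟨hx.2, hx.1⟩).symm
    · exact T.noncrossing f (Finset.mem_of_mem_erase hf) g (Finset.mem_of_mem_erase hg) hfg x hx

/-- Subgraph of a plane graph. -/
def subG {S : Finset Pt} (T : PlaneGraph S) (E : Finset (Sym2 Pt)) (h : E ⊆ T.edges) :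
    PlaneGraph S where
  edges := E
  endpoint_mem := fun f hf => T.endpoint_mem f (h hf)
  not_isDiag := fun f hf => T.not_isDiag f (h hf)
  noncrossing := fun f hf g hg => T.noncrossing f (h hf) g (h hg)

lemma supp_add {S : Finset Pt} {G G₁ G₂ : PlaneGraph S} (h₁ : G.edges ⊆ G₁.edges)
    (h₂ : G.edges ⊆ G₂.edges)
    (hdis : ∀ T : PlaneGraph S, G₁.edges ⊆ T.edges → G₂.edges ⊆ T.edges → False) :
    supp G₁ + supp G₂ ≤ supp G := by
  have e : ∀ H : PlaneGraph S, supp H =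
      ({T : PlaneGraph S | IsTriangulation T ∧ H.edges ⊆ T.edges} : Set (PlaneGraph S)).ncard :=
    fun H => rfl
  rw [e, e, e, ← Set.ncard_union_eq ?_ (Set.toFinite _) (Set.toFinite _)]
  · apply Set.ncard_le_ncard _ (Set.toFinite _)
    rintro T (⟨hT, hs⟩ | ⟨hT, hs⟩)
    · exact ⟨hT, h₁.trans hs⟩
    · exact ⟨hT, h₂.trans hs⟩
  · rw [Set.disjoint_left]
    rintro T ⟨_, hs⟩ ⟨_, hs'⟩
    exact hdis T hs hs'

lemma main_count {S : Finset Pt} (hS : GenPos S) (𝒬 : Finset (Finset Pt))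
    (hne : ∀ Q ∈ 𝒬, (interior (convexHull ℝ (Q : Set Pt))).Nonempty)
    (hdis : ∀ Q ∈ 𝒬, ∀ Q' ∈ 𝒬, Q ≠ Q' →
      interior (convexHull ℝ (Q : Set Pt)) ∩ interior (convexHull ℝ (Q' : Set Pt)) = ∅)
    (n : ℕ) : ∀ (T G : PlaneGraph S) (F : Finset (Sym2 Pt)), F.card = n → F ⊆ T.edges →
      (∀ Q ∈ 𝒬, GoodPoly T Q) → (∀ e ∈ F, ∃ Q ∈ 𝒬, IsDiagonalOf Q e) →
      G.edges ⊆ T.edges → Disjoint G.edges F → 2 ^ n ≤ supp G := by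
  induction n with
  | zero =>
    intro T G F _ _ _ _ _ _
    obtain ⟨T', hT', hs⟩ := exists_triangulation G
    have : Nonempty {T : PlaneGraph S // IsTriangulation T ∧ G.edges ⊆ T.edges} := ⟨⟨T', hT', hs⟩⟩
    exact Nat.card_pos
  | succ n ih =>
    intro T G F hcard hFT hgood hdiag hGT hGF
    obtain ⟨e, he⟩ : F.Nonempty := by rw [← Finset.card_pos]; omega
    obtain ⟨Q, hQ, p, hp, q, hq, rfl, hpq⟩ := hdiag e he
    have hcard' : (F.erase s(p, q)).card = n := by rw [Finset.card_erase_of_mem he]; omega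
    have hpqT := hFT he
    have hpqne : p ≠ q := by
      rintro rfl
      exact T.not_isDiag _ hpqT (by simp)
    have heG : s(p, q) ∉ G.edges := fun h => Finset.disjoint_left.1 hGF h he
    obtain ⟨c, d, hc, hd, hcd, hcdne, ⟨y, hy1, hy2⟩, hnc⟩ :=
      exists_flip hS (hgood Q hQ) hp hq hpqT hpq
    set T' := addEdge T s(p, q) c d hc hd hcd hnc with hT'
    have hT'e : T'.edges = insert s(c, d) (T.edges.erase s(p, q)) := rfl
    have hcdpq : ∀ H : PlaneGraph S, s(c, d) ∈ H.edges →
        s(p, q) ∈ H.edges → False := by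
      intro H h1 h2
      have := H.noncrossing _ h1 _ h2 hcdne y
        ⟨openSegment_subset_segment ℝ _ _ hy2, openSegment_subset_segment ℝ _ _ hy1⟩
      exact not_mem_endpoints hpqne hy1 this.2
    have hm : (midpoint ℝ p q) ∈ openSegment ℝ p q := midpoint_mem_openSegment p q
    have hgood' : ∀ Q' ∈ 𝒬, GoodPoly T' Q' := by
      intro Q' hQ'
      obtain ⟨g1, g2, g3, g4, g5⟩ := hgood Q' hQ'
      refine ⟨g1, g2, g3, ?_, g5⟩
      intro u v huv
      rw [hT'e]
      refine Finset.mem_insert_of_mem (Finset.mem_erase.2 ⟨?_, g4 u v huv⟩)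
      intro heq
      have hmf : midpoint ℝ p q ∈ frontier (convexHull ℝ (Q' : Set Pt)) := by
        apply huv.2.2.2
        have : midpoint ℝ p q ∈ seg2 s(p, q) := openSegment_subset_segment ℝ _ _ hm
        rw [← heq] at this
        exact this
      by_cases hQQ : Q = Q'
      · subst hQQ
        exact hmf.2 (hpq hm)
      · have hcl : midpoint ℝ p q ∈ closure (interior (convexHull ℝ (Q' : Set Pt))) := by
          rw [(convex_convexHull ℝ _).closure_interior_eq_closure_of_nonempty_interior
            (hne Q' hQ')]
          exact hmf.1
        obtain ⟨z, hz⟩ := mem_closure_iff.1 hcl _ isOpen_interior (hpq hm)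
        rw [hdis Q hQ Q' hQ' hQQ] at hz
        exact hz
    have hG1 : insert s(p, q) G.edges ⊆ T.edges := Finset.insert_subset hpqT hGT
    have hG2 : insert s(c, d) G.edges ⊆ T'.edges := by
      rw [hT'e]
      apply Finset.insert_subset_insert
      intro f hf
      exact Finset.mem_erase.2 ⟨fun h => heG (h ▸ hf), hGT hf⟩
    have hGF' : Disjoint G.edges (F.erase s(p, q)) :=
      hGF.mono_right (Finset.erase_subset _ _)
    have i1 := ih T (subG T _ hG1) (F.erase s(p, q)) hcard'
      ((Finset.erase_subset _ _).trans hFT) hgood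
      (fun f hf => hdiag f (Finset.mem_of_mem_erase hf)) hG1
      (by
        show Disjoint (insert s(p, q) G.edges) _
        rw [Finset.disjoint_insert_left]
        exact ⟨Finset.notMem_erase _ _, hGF'⟩)
    have i2 := ih T' (subG T' _ hG2) (F.erase s(p, q)) hcard'
      (by
        rw [hT'e]
        exact (Finset.erase_subset_erase _ hFT).trans (Finset.subset_insert _ _)) hgood'
      (fun f hf => hdiag f (Finset.mem_of_mem_erase hf)) hG2
      (by
        show Disjoint (insert s(c, d) G.edges) _
        rw [Finset.disjoint_insert_left]
        exact ⟨fun h => hcdpq T (hFT (Finset.mem_of_mem_erase h)) hpqT, hGF'⟩)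
    have i3 : supp (subG T _ hG1) + supp (subG T' _ hG2) ≤ supp G := by
      apply supp_add
      · exact Finset.subset_insert _ _
      · exact Finset.subset_insert _ _
      · intro H h1 h2
        exact hcdpq H (h2 (Finset.mem_insert_self _ _)) (h1 (Finset.mem_insert_self _ _))
    rw [pow_succ]
    omega

/-- If `F` is a set of `N/2 - 2` ps-flippable edges of a
triangulation `T` and `G ⊆ T` misses exactly `j` edges of `F`, then
`supp(G) ≥ 2^j`. -/
theorem statement5 (S : Finset Pt) (hS : GenPos S) (T : PlaneGraph S)
    (hT : IsTriangulation T) (F : Finset (Sym2 Pt)) (hF : IsPsFlippable T F)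
    (hFcard : (F.card : ℝ) = (S.card : ℝ) / 2 - 2)
    (G : PlaneGraph S) (hG : G.edges ⊆ T.edges)
    (j : ℕ) (hj : (F \ G.edges).card = j) :
    2 ^ j ≤ supp G := by
  obtain ⟨hFT, 𝒬, hgood, hdis, hdiag⟩ := hF
  refine main_count hS
    (𝒬.filter (fun Q => (interior (convexHull ℝ (Q : Set Pt))).Nonempty))
    (fun Q hQ => (Finset.mem_filter.1 hQ).2)
    (fun Q hQ Q' hQ' => hdis Q (Finset.mem_filter.1 hQ).1 Q' (Finset.mem_filter.1 hQ').1)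
    j T G (F \ G.edges) hj (Finset.sdiff_subset.trans hFT)
    (fun Q hQ => hgood Q (Finset.mem_filter.1 hQ).1) ?_ hG Finset.disjoint_sdiff
  intro e he
  obtain ⟨Q, hQ, p, hp, q, hq, rfl, hpq⟩ := hdiag e (Finset.sdiff_subset he)
  exact ⟨Q, Finset.mem_filter.2 ⟨hQ, midpoint ℝ p q, hpq (midpoint_mem_openSegment p q)⟩,
    p, hp, q, hq, rfl, hpq⟩

end
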